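/- Let γ > 0 and let m be a nonnegative integer with m < 2eγ, where e is Euler's number. Then for every λ > 0 and every integer i ≥ 1, e^{−2γ i} · i^m / (λ + e^{−2γ i}) ≤ λ^{−m/(2eγ)}. -/

import Mathlib

theorem le_exp_div_exp_one (x : ℝ) : x ≤ Real.exp (x / Real.exp 1) := by
  have h := Real.add_one_le_exp (x / Real.exp 1 - 1)
  rwa [sub_add_cancel, Real.exp_sub, div_le_div_iff_of_pos_right (Real.exp_pos 1)] at h

theorem rpow_mul_rpow_one_sub_le_add {a b θ : ℝ} (ha : 0 ≤ a) (hb : 0 ≤ b) (hθ₀ : 0 ≤ θ)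
    (hθ₁ : θ ≤ 1) : a ^ θ * b ^ (1 - θ) ≤ a + b := by
  have h := Real.geom_mean_le_arith_mean2_weighted hθ₀ (sub_nonneg.2 hθ₁) ha hb (by ring)
  nlinarith [mul_nonneg (sub_nonneg.2 hθ₁) ha, mul_nonneg hθ₀ hb]

/-- Pointwise estimate from the proof of Theorem 5: for `γ > 0`, a nonnegative integer
`m < 2eγ`, every `λ > 0` and every integer `i ≥ 1`,
`e^{-2γi} iᵐ / (λ + e^{-2γi}) ≤ λ^{-m/(2eγ)}`. -/
theorem pointwise_bound_exponential_eigenvalues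
    (γ : ℝ) (hγ : 0 < γ) (m : ℕ) (hm : (m : ℝ) < 2 * Real.exp 1 * γ) :
    ∀ lam : ℝ, 0 < lam → ∀ i : ℕ, 1 ≤ i →
      Real.exp (-2 * γ * (i : ℝ)) * (i : ℝ) ^ m / (lam + Real.exp (-2 * γ * (i : ℝ))) ≤
        lam ^ (-(m : ℝ) / (2 * Real.exp 1 * γ)) := by
  intro lam hlam i _
  have he := Real.exp_pos 1
  have hden : 0 < 2 * Real.exp 1 * γ := by positivity
  set θ : ℝ := (m : ℝ) / (2 * Real.exp 1 * γ) with hθ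
  have hθ₀ : 0 ≤ θ := by positivity
  have hθ₁ : θ ≤ 1 := (div_le_one hden).2 hm.le
  have hpow : Real.exp (-2 * γ * i) * (i : ℝ) ^ m ≤ Real.exp (-2 * γ * i) ^ (1 - θ) :=
    calc
      _ ≤ Real.exp (-2 * γ * i) * Real.exp (i / Real.exp 1) ^ m := by
        gcongr
        exact le_exp_div_exp_one _
      _ = Real.exp (-2 * γ * i) ^ (1 - θ) := by
        rw [← Real.exp_nat_mul, ← Real.exp_add, ← Real.exp_mul, hθ]
        congr 1
        field_simp
        ring
  rw [neg_div, ← hθ, Real.rpow_neg hlam.le, div_le_iff₀ (by positivity),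
    le_inv_mul_iff₀ (by positivity)]
  exact (mul_le_mul_of_nonneg_left hpow (by positivity)).trans
    (rpow_mul_rpow_one_sub_le_add hlam.le (Real.exp_pos _).le hθ₀ hθ₁)
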